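/- Let n ∈ ℕ, k ∈ ℕ∪{0}, 1 < p < ∞, η > 0 and a > 1. Then there exists a constant C > 0 such that for every u ∈ C_c^∞(B_η), ∫_{B_η} |∇u(x)|^p w^{sl}_{k,1}(|x|)^{p−1} |x|^{1−n} dx ≥ (1/p')^p · ∫_{B_η} |u(x)|^p |x|^{1−n} / ( w^{sl}_{k,1}(|x|) · A^1_{k+1}(η/|x|)^p ) dx + C · ∫_{B_η} |u(x)|^p |x|^{1−n} / ( w^{sl}_{k,1}(|x|) · A^1_{k+1}(η/|x|)^p · ( a − log a + log A^1_{k+1}(η/|x|) )^2 ) dx. -/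

import Mathlib

open Real MeasureTheory Filter Topology Set

/-- `F(u) = a - log a + log u`. -/
noncomputable def Fa (a : ℝ) : ℝ → ℝ := fun u => a - Real.log a + Real.log u

/-- `F̃(u) = a · ∏_{k=0}^∞ (F^k(u)/a)`. -/
noncomputable def Ftilde (a : ℝ) (u : ℝ) : ℝ := a * ∏' k : ℕ, ((Fa a)^[k] u / a)

/-- `φ(u) = a + ∫_a^u dt / F̃(t)`. -/
noncomputable def phiFun (a : ℝ) (u : ℝ) : ℝ := a + ∫ t in a..u, 1 / Ftilde a t

/-- The super-logarithm: `L(r) = φ(ar) - a` for `r ≥ 1` and `L(r) = -L(1/r)` for `0 < r < 1`. -/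
noncomputable def superLog (a : ℝ) (r : ℝ) : ℝ :=
  if 1 ≤ r then phiFun a (a * r) - a else -(phiFun a (a * (1 / r)) - a)

/-- `A^0_k(r) = F^k(ar)`. -/
noncomputable def A0 (a : ℝ) (k : ℕ) (r : ℝ) : ℝ := (Fa a)^[k] (a * r)

/-- `A^1_k(r) = F^k(φ(ar))` (with `A^1_0(r) = φ(ar)`). -/
noncomputable def A1 (a : ℝ) (k : ℕ) (r : ℝ) : ℝ := (Fa a)^[k] (phiFun a (a * r))

/-- `B^0(r) = F̃(ar)/(ar)`. -/
noncomputable def B0 (a : ℝ) (r : ℝ) : ℝ := Ftilde a (a * r) / (a * r)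

/-- `w^{sl}_{k,α}(t) = t · B^0(η/t) · (∏_{j=0}^{k-1} A^1_j(η/t)) · A^1_k(η/t)^α`. -/
noncomputable def wsl (a : ℝ) (k : ℕ) (α : ℝ) (η : ℝ) (t : ℝ) : ℝ :=
  t * B0 a (η / t) * (∏ j ∈ Finset.range k, A1 a j (η / t)) * (A1 a k (η / t)) ^ α


lemma sl_Fa_ge {a : ℝ} (ha : 1 < a) {u : ℝ} (hu : a ≤ u) : a ≤ Fa a u := by
  have := Real.log_le_log (by linarith) hu
  unfold Fa; linarith

lemma sl_Fa_div {a : ℝ} (ha : 1 < a) {u : ℝ} (hu : a ≤ u) :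
    Fa a u / a = 1 + Real.log (u / a) / a := by
  have h0 : a ≠ 0 := by linarith
  have h1 : u ≠ 0 := by linarith
  unfold Fa
  rw [Real.log_div h1 h0]
  field_simp
  ring

lemma sl_log_nonneg {a : ℝ} (ha : 1 < a) {u : ℝ} (hu : a ≤ u) : 0 ≤ Real.log (u / a) := by
  apply Real.log_nonneg
  rw [le_div_iff₀ (by linarith)]; linarith

lemma sl_Fa_le {a : ℝ} (ha : 1 < a) {u : ℝ} (hu : a ≤ u) : Fa a u ≤ u := by
  have h0 : 0 < a := by linarith
  have h2 : Real.log (u / a) ≤ u / a - 1 := Real.log_le_sub_one_of_pos (div_pos (by linarith) h0)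
  have h3 : Fa a u = a + Real.log (u / a) := by
    unfold Fa; rw [Real.log_div (by linarith) (by linarith)]; ring
  have h4 : u / a - 1 ≤ u - a := by
    rw [div_sub_one (by linarith), div_le_iff₀ h0]; nlinarith
  linarith

lemma sl_iter_ge {a : ℝ} (ha : 1 < a) {u : ℝ} (hu : a ≤ u) (k : ℕ) : a ≤ (Fa a)^[k] u := by
  induction k with
  | zero => simpa
  | succ k ih => rw [Function.iterate_succ_apply']; exact sl_Fa_ge ha ih

lemma sl_iter_le {a : ℝ} (ha : 1 < a) {u : ℝ} (hu : a ≤ u) (k : ℕ) : (Fa a)^[k] u ≤ u := by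
  induction k with
  | zero => simp
  | succ k ih =>
    rw [Function.iterate_succ_apply']; exact (sl_Fa_le ha (sl_iter_ge ha hu k)).trans ih

lemma sl_log_iter {a : ℝ} (ha : 1 < a) {u : ℝ} (hu : a ≤ u) (k : ℕ) :
    Real.log ((Fa a)^[k] u / a) ≤ Real.log (u / a) * (a⁻¹) ^ k := by
  induction k with
  | zero => simp
  | succ k ih =>
    have hg := sl_iter_ge ha hu k
    rw [Function.iterate_succ_apply', sl_Fa_div ha hg]
    have h0 : 0 < a := by linarith
    have hl := sl_log_nonneg ha hg
    have hd : 0 ≤ Real.log ((Fa a)^[k] u / a) / a := div_nonneg hl h0.le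
    have := Real.log_le_sub_one_of_pos (x := 1 + Real.log ((Fa a)^[k] u / a) / a) (by linarith)
    calc _ ≤ Real.log ((Fa a)^[k] u / a) / a := by linarith
      _ ≤ Real.log (u / a) * (a⁻¹) ^ k / a := by gcongr
      _ = _ := by rw [pow_succ]; field_simp

lemma sl_geo {a : ℝ} (ha : 1 < a) : HasSum (fun k : ℕ => (a⁻¹) ^ k) (1 - a⁻¹)⁻¹ :=
  hasSum_geometric_of_lt_one (by positivity) (inv_lt_one_of_one_lt₀ ha)

lemma sl_summable {a : ℝ} (ha : 1 < a) {u : ℝ} (hu : a ≤ u) :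
    Summable fun k : ℕ => Real.log ((Fa a)^[k] u / a) :=
  Summable.of_nonneg_of_le (fun k => sl_log_nonneg ha (sl_iter_ge ha hu k))
    (fun k => sl_log_iter ha hu k) ((sl_geo ha).summable.mul_left _)

lemma sl_Ftilde_eq {a : ℝ} (ha : 1 < a) {u : ℝ} (hu : a ≤ u) :
    Ftilde a u = a * Real.exp (∑' k : ℕ, Real.log ((Fa a)^[k] u / a)) := by
  unfold Ftilde
  rw [Real.rexp_tsum_eq_tprod _ (sl_summable ha hu)]
  intro k
  exact div_pos (by linarith [sl_iter_ge ha hu k]) (by linarith)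

lemma sl_tsum_le {a : ℝ} (ha : 1 < a) {u : ℝ} (hu : a ≤ u) :
    ∑' k : ℕ, Real.log ((Fa a)^[k] u / a) ≤ Real.log (u / a) * (1 - a⁻¹)⁻¹ :=
  ((sl_summable ha hu).tsum_le_tsum (fun k => sl_log_iter ha hu k)
    ((sl_geo ha).summable.mul_left _)).trans_eq ((sl_geo ha).mul_left _).tsum_eq

lemma sl_Ftilde_ge {a : ℝ} (ha : 1 < a) {u : ℝ} (hu : a ≤ u) : u ≤ Ftilde a u := by
  rw [sl_Ftilde_eq ha hu]
  have h0 : 0 < a := by linarith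
  have h := (sl_summable ha hu).le_tsum 0 (fun k _ => sl_log_nonneg ha (sl_iter_ge ha hu k))
  have h2 := Real.exp_le_exp.2 h
  rw [Function.iterate_zero_apply, Real.exp_log (div_pos (by linarith) h0), div_le_iff₀ h0] at h2
  linarith

lemma sl_Ftilde_le {a : ℝ} (ha : 1 < a) {u : ℝ} (hu : a ≤ u) :
    Ftilde a u ≤ u * (Fa a u / a) ^ ((1 - a⁻¹)⁻¹) := by
  have h0 : 0 < a := by linarith
  have hF := sl_Fa_ge ha hu
  rw [sl_Ftilde_eq ha hu, (sl_summable ha hu).tsum_eq_zero_add, Real.exp_add]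
  simp only [Function.iterate_succ_apply, Function.iterate_zero_apply]
  rw [Real.exp_log (div_pos (by linarith) h0), ← mul_assoc, mul_div_cancel₀ _ h0.ne']
  have := sl_tsum_le ha hF
  rw [Real.rpow_def_of_pos (div_pos (by linarith) h0)]
  have hu0 : 0 ≤ u := by linarith
  gcongr

lemma sl_Fa_cont {a : ℝ} (ha : 1 < a) : ContinuousOn (Fa a) (Ici a) := by
  unfold Fa
  refine continuousOn_const.add (Real.continuousOn_log.mono ?_)
  intro x hx
  have : a ≤ x := hx
  simp; linarith

lemma sl_iter_cont {a : ℝ} (ha : 1 < a) (k : ℕ) : ContinuousOn ((Fa a)^[k]) (Ici a) :=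
  (sl_Fa_cont ha).iterate (fun _ hx => sl_Fa_ge ha hx) k

lemma sl_Ftilde_cont {a : ℝ} (ha : 1 < a) : ContinuousOn (Ftilde a) (Ici a) := by
  have h0 : 0 < a := by linarith
  have key : ∀ R, ContinuousOn (Ftilde a) (Icc a R) := by
    intro R
    have : ContinuousOn (fun u => a * Real.exp (∑' k : ℕ, Real.log ((Fa a)^[k] u / a)))
        (Icc a R) := by
      refine continuousOn_const.mul (Real.continuous_exp.comp_continuousOn ?_)
      refine continuousOn_tsum (u := fun k => Real.log (R / a) * (a⁻¹) ^ k) ?_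
        ((sl_geo ha).summable.mul_left _) ?_
      · intro k
        refine ContinuousOn.log
          (((sl_iter_cont ha k).mono Icc_subset_Ici_self).div_const a) ?_
        intro x hx
        have := sl_iter_ge ha hx.1 k
        exact (div_pos (by linarith) h0).ne'
      · intro k x hx
        rw [Real.norm_of_nonneg (sl_log_nonneg ha (sl_iter_ge ha hx.1 k))]
        refine (sl_log_iter ha hx.1 k).trans ?_
        have : Real.log (x / a) ≤ Real.log (R / a) :=
          Real.log_le_log (div_pos (by linarith [hx.1]) h0) (by gcongr; exact hx.2)
        gcongr
    exact this.congr fun x hx => sl_Ftilde_eq ha hx.1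
  intro x hx
  have h1 := key (x + 1) x ⟨hx, by linarith⟩
  refine h1.mono_of_mem_nhdsWithin ?_
  rw [← Ici_inter_Iic]
  exact inter_mem self_mem_nhdsWithin (mem_nhdsWithin_of_mem_nhds (Iic_mem_nhds (by linarith)))

lemma sl_inv_cont {a : ℝ} (ha : 1 < a) : ContinuousOn (fun t => 1 / Ftilde a t) (Ici a) :=
  continuousOn_const.div (sl_Ftilde_cont ha) fun x hx => by
    have h1 : a ≤ x := hx
    have := sl_Ftilde_ge ha h1
    linarith

lemma sl_inv_int {a : ℝ} (ha : 1 < a) {u : ℝ} (hu : a ≤ u) :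
    IntervalIntegrable (fun t => 1 / Ftilde a t) volume a u :=
  ((sl_inv_cont ha).mono (by rw [uIcc_of_le hu]; exact Icc_subset_Ici_self)).intervalIntegrable

lemma sl_phi_ge {a : ℝ} (ha : 1 < a) {u : ℝ} (hu : a ≤ u) : a ≤ phiFun a u := by
  unfold phiFun
  have : 0 ≤ ∫ t in a..u, 1 / Ftilde a t := by
    refine intervalIntegral.integral_nonneg hu fun t ht => ?_
    have := sl_Ftilde_ge ha ht.1
    have := ht.1
    exact div_nonneg zero_le_one (by linarith)
  linarith

lemma sl_phi_le {a : ℝ} (ha : 1 < a) {u : ℝ} (hu : a ≤ u) : phiFun a u ≤ Fa a u := by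
  have h0 : 0 < a := by linarith
  have h1 : ∫ t in a..u, 1 / Ftilde a t ≤ ∫ t in a..u, 1 / t := by
    refine intervalIntegral.integral_mono_on hu (sl_inv_int ha hu) ?_ fun t ht => ?_
    · refine (continuousOn_const.div continuousOn_id fun t ht => ?_).intervalIntegrable
      rw [uIcc_of_le hu] at ht
      exact (lt_of_lt_of_le h0 ht.1).ne'
    · have := sl_Ftilde_ge ha ht.1
      have := ht.1
      gcongr
      linarith
  rw [integral_one_div_of_pos h0 (by linarith), Real.log_div (by linarith) (by linarith)] at h1
  unfold phiFun Fa; linarith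

lemma sl_phi_deriv {a : ℝ} (ha : 1 < a) {u : ℝ} (hu : a < u) :
    HasDerivAt (phiFun a) (1 / Ftilde a u) u := by
  unfold phiFun
  refine HasDerivAt.const_add a ?_
  refine intervalIntegral.integral_hasDerivAt_right (sl_inv_int ha hu.le) ?_
    ((sl_inv_cont ha).continuousAt (Ici_mem_nhds hu))
  exact (sl_inv_cont ha).mono Ioi_subset_Ici_self |>.stronglyMeasurableAtFilter isOpen_Ioi u hu

lemma sl_arg {a η t : ℝ} (ha : 1 < a) (ht : t ∈ Ioo 0 η) : a < a * (η / t) := by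
  have : 1 < η / t := (one_lt_div ht.1).2 ht.2
  nlinarith

lemma sl_A1_ge {a η t : ℝ} (ha : 1 < a) (ht : t ∈ Ioo 0 η) (k : ℕ) : a ≤ A1 a k (η / t) :=
  sl_iter_ge ha (sl_phi_ge ha (sl_arg ha ht).le) k

lemma sl_A1_le {a η t : ℝ} (ha : 1 < a) (ht : t ∈ Ioo 0 η) (k : ℕ) :
    A1 a k (η / t) ≤ Fa a (a * (η / t)) :=
  (sl_iter_le ha (sl_phi_ge ha (sl_arg ha ht).le) k).trans (sl_phi_le ha (sl_arg ha ht).le)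

lemma sl_B0_pos {a η t : ℝ} (ha : 1 < a) (ht : t ∈ Ioo 0 η) : 0 < B0 a (η / t) := by
  have h := sl_arg ha ht
  have := sl_Ftilde_ge ha h.le
  exact div_pos (by linarith) (by linarith)

lemma sl_w_eq (a : ℝ) (k : ℕ) (η t : ℝ) :
    wsl a k 1 η t = t * B0 a (η / t) * ∏ j ∈ Finset.range (k + 1), A1 a j (η / t) := by
  unfold wsl
  rw [Real.rpow_one, Finset.prod_range_succ]; ring

lemma sl_w_pos {a η t : ℝ} (ha : 1 < a) (ht : t ∈ Ioo 0 η) (k : ℕ) : 0 < wsl a k 1 η t := by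
  rw [sl_w_eq]
  refine mul_pos (mul_pos ht.1 (sl_B0_pos ha ht)) (Finset.prod_pos fun j _ => ?_)
  linarith [sl_A1_ge ha ht j]

lemma sl_A1_deriv {a η t : ℝ} (ha : 1 < a) (ht : t ∈ Ioo 0 η) (k : ℕ) :
    HasDerivAt (fun t => A1 a k (η / t))
      (-1 / (t * B0 a (η / t) * ∏ j ∈ Finset.range k, A1 a j (η / t))) t := by
  have ht0 : t ≠ 0 := ht.1.ne'
  have hη : η ≠ 0 := (ht.1.trans ht.2).ne'
  have ha0 : a ≠ 0 := by linarith
  induction k with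
  | zero =>
    have h1 : HasDerivAt (fun t : ℝ => a * (η / t)) (a * (-η / t ^ 2)) t := by
      have := ((hasDerivAt_inv ht0).const_mul η).const_mul a
      simp only [div_eq_mul_inv]
      refine this.congr_deriv ?_
      ring
    have h2 := (sl_phi_deriv ha (sl_arg ha ht)).comp t h1
    have h3 : Ftilde a (a * (η / t)) ≠ 0 := by
      have h := sl_arg ha ht
      have := sl_Ftilde_ge ha h.le
      linarith
    refine HasDerivAt.congr_deriv (f := fun t => A1 a 0 (η / t)) h2 ?_
    unfold B0
    simp
    field_simp
  | succ k ih =>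
    have hA : A1 a k (η / t) ≠ 0 := by linarith [sl_A1_ge ha ht k]
    have h1 := (ih.log hA).const_add (a - Real.log a)
    have h2 : (fun t => A1 a (k + 1) (η / t)) =
        fun x => a - Real.log a + Real.log (A1 a k (η / x)) := by
      funext s
      simp only [A1, Function.iterate_succ_apply']
      rfl
    rw [h2]
    refine h1.congr_deriv ?_
    rw [Finset.prod_range_succ, ← mul_assoc, div_div]

lemma sl_s_deriv {a η t : ℝ} (ha : 1 < a) (ht : t ∈ Ioo 0 η) (k : ℕ) :
    HasDerivAt (fun t => A1 a (k + 1) (η / t)) (-1 / wsl a k 1 η t) t := by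
  rw [sl_w_eq]; exact sl_A1_deriv ha ht (k + 1)

lemma sl_w_cont {a η : ℝ} (ha : 1 < a) (k : ℕ) : ContinuousOn (wsl a k 1 η) (Ioo 0 η) := by
  have h0 : ContinuousOn (fun t : ℝ => η / t) (Ioo 0 η) :=
    continuousOn_const.div continuousOn_id fun t ht => ht.1.ne'
  have h1 : ContinuousOn (fun t : ℝ => a * (η / t)) (Ioo 0 η) := continuousOn_const.mul h0
  have h2 : ContinuousOn (fun t : ℝ => B0 a (η / t)) (Ioo 0 η) := by
    refine ContinuousOn.div ((sl_Ftilde_cont ha).comp h1 fun t ht => (sl_arg ha ht).le) h1 ?_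
    intro t ht
    have := sl_arg ha ht
    linarith
  refine ((continuousOn_id.mul h2).mul (continuousOn_finsetProd _ fun j _ => ?_)).congr
    fun t ht => sl_w_eq a k η t
  exact fun t ht => (sl_A1_deriv ha ht j).continuousAt.continuousWithinAt

lemma sl_w_le {a η : ℝ} (ha : 1 < a) (k : ℕ) : ∃ W, ∀ t ∈ Ioo 0 η, wsl a k 1 η t ≤ W := by
  have h0 : 0 < a := by linarith
  set q := (1 - a⁻¹)⁻¹ with hq
  have hq0 : 0 ≤ q := by
    have := inv_lt_one_of_one_lt₀ ha
    exact inv_nonneg.2 (by linarith)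
  set M : ℝ := q + (k + 1 : ℕ) with hM
  have hM1 : 1 ≤ M := by
    rw [hM]; push_cast
    have : (0 : ℝ) ≤ k := by positivity
    linarith
  refine ⟨a ^ (k + 1) * M ^ M * η, fun t ht => ?_⟩
  have hη : 0 < η := ht.1.trans ht.2
  have hu := sl_arg ha ht
  set u := a * (η / t) with hu'
  have hua : u / a = η / t := by rw [hu']; field_simp
  set y := Fa a u / a with hy
  have hy1 : 1 ≤ y := by rw [hy, one_le_div h0]; exact sl_Fa_ge ha hu.le
  have hB : B0 a (η / t) ≤ y ^ q := by
    unfold B0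
    rw [← hu', div_le_iff₀ (by linarith), mul_comm]
    exact sl_Ftilde_le ha hu.le
  have hP : ∏ j ∈ Finset.range (k + 1), A1 a j (η / t) ≤ (a * y) ^ (k + 1) := by
    have : ∏ j ∈ Finset.range (k + 1), A1 a j (η / t) ≤ ∏ j ∈ Finset.range (k + 1), (a * y) := by
      refine Finset.prod_le_prod (fun j _ => by linarith [sl_A1_ge ha ht j]) fun j _ => ?_
      rw [hy, mul_div_cancel₀ _ h0.ne']
      exact sl_A1_le ha ht j
    simpa using this
  have hP0 : 0 ≤ ∏ j ∈ Finset.range (k + 1), A1 a j (η / t) :=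
    Finset.prod_nonneg fun j _ => by linarith [sl_A1_ge ha ht j]
  have hx0 := sl_log_nonneg ha hu.le
  have hyM : y ^ M ≤ M ^ M * (η / t) := by
    have e1 : y ≤ M * Real.exp (Real.log (u / a) / M) := by
      rw [hy, sl_Fa_div ha hu.le]
      have e2 := Real.add_one_le_exp (Real.log (u / a) / M)
      have e3 : Real.log (u / a) / a ≤ Real.log (u / a) := div_le_self hx0 ha.le
      have e4 : M * (Real.log (u / a) / M + 1) = Real.log (u / a) + M := by field_simp
      have e5 : M * (Real.log (u / a) / M + 1) ≤ M * Real.exp (Real.log (u / a) / M) := by gcongr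
      linarith
    calc y ^ M ≤ (M * Real.exp (Real.log (u / a) / M)) ^ M :=
          Real.rpow_le_rpow (by linarith) e1 (by linarith)
      _ = M ^ M * (η / t) := by
        rw [Real.mul_rpow (by linarith) (Real.exp_pos _).le, ← Real.exp_mul,
          div_mul_cancel₀ _ (by linarith), Real.exp_log, hua]
        rw [hua]; exact div_pos hη ht.1
  have hy0 : 0 < y := by linarith
  rw [sl_w_eq]
  calc _ ≤ t * y ^ q * (a * y) ^ (k + 1) := by
        have := ht.1.le
        have := (sl_B0_pos ha ht).le
        gcongr
    _ = t * a ^ (k + 1) * y ^ M := by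
        rw [hM, Real.rpow_add hy0, Real.rpow_natCast]; ring
    _ ≤ t * a ^ (k + 1) * (M ^ M * (η / t)) := by
        have := ht.1.le
        gcongr
    _ = _ := by have := ht.1.ne'; field_simp

lemma hd_exp {q : ℝ} (hq : 0 < q) {ε : ℝ} (h0 : 0 ≤ ε) (h1 : ε ≤ 1) :
    (1 + ε) ^ q ≤ 1 + q * ε + q ^ 2 * Real.exp q * ε ^ 2 := by
  have e0 : (1 + ε) ^ q ≤ Real.exp (q * ε) := by
    rw [mul_comm, Real.exp_mul]
    exact Real.rpow_le_rpow (by linarith) (by linarith [Real.add_one_le_exp ε]) hq.le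
  have key : ∀ x : ℝ, Real.exp x ≤ 1 + x * Real.exp x := by
    intro x
    have h := Real.add_one_le_exp (-x)
    have h2 : Real.exp x * Real.exp (-x) = 1 := by rw [← Real.exp_add]; simp
    nlinarith [Real.exp_pos x]
  have hx : 0 ≤ q * ε := by positivity
  have e1 : Real.exp (q * ε) ≤ Real.exp q := Real.exp_le_exp.2 (by nlinarith)
  have e2 := key (q * ε)
  have e3 : q * ε * Real.exp (q * ε) ≤ q * ε * (1 + q * ε * Real.exp q) := by
    gcongr
    exact e2.trans (by gcongr)
  nlinarith

lemma hd_const {p : ℝ} (hp : 1 < p) : ∃ c C : ℝ, 0 < c ∧ 0 < C ∧ ∀ L : ℝ, 1 ≤ L →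
    (1 / (p / (p - 1))) ^ p + C / L ^ 2 ≤ (1 / (p / (p - 1))) ^ (p - 1) *
      ((p - 1) * (1 + c / L) + c / L ^ 2) -
      (p - 1) * ((1 / (p / (p - 1))) ^ p * (1 + c / L) ^ (p / (p - 1))) := by
  set q := p / (p - 1) with hq
  have hp1 : 0 < p - 1 := by linarith
  have hq0 : 0 < q := by positivity
  set κ := 1 / q with hκ
  have hκ0 : 0 < κ := by positivity
  have hκp : κ ^ p = κ ^ (p - 1) * κ := by
    rw [← Real.rpow_add_one hκ0.ne']; ring_nf
  set K := κ ^ (p - 1) with hK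
  have hK0 : 0 < K := by positivity
  set M := q ^ 2 * Real.exp q with hM
  have hM0 : 0 < M := by positivity
  set D := 2 * (p - 1) * κ * M + 1 with hD
  have hD1 : 1 ≤ D := by
    have : 0 ≤ 2 * (p - 1) * κ * M := by positivity
    linarith
  have hD0 : 0 < D := by linarith
  refine ⟨1 / D, K * (1 / D) / 2, by positivity, by positivity, fun L hL => ?_⟩
  set c := 1 / D with hc
  have hc0 : 0 < c := by positivity
  have hc1 : c ≤ 1 := by rw [hc, div_le_one hD0]; exact hD1
  have hcD : c * D = 1 := by rw [hc]; field_simp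
  have hL0 : 0 < L := by linarith
  set ε := c / L with hε
  have hε0 : 0 ≤ ε := by positivity
  have hε1 : ε ≤ 1 := by rw [hε, div_le_one hL0]; linarith
  have hT := hd_exp hq0 hε0 hε1
  have hcL : c / L ^ 2 = ε ^ 2 * D := by
    rw [hε]; field_simp; linear_combination -hcD
  have hCL : K * c / 2 / L ^ 2 = K / 2 * (ε ^ 2 * D) := by rw [← hcL]; ring
  have hκq : κ * q = 1 := by rw [hκ]; field_simp
  have hpk : (p - 1) * (1 - κ) = κ := by
    rw [hκ, hq]; field_simp; ring
  rw [hCL, hcL, hκp]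
  have h1 : (p - 1) * (K * κ * (1 + ε) ^ q) ≤
      (p - 1) * (K * κ * (1 + q * ε + M * ε ^ 2)) := by gcongr
  have h2 : (p - 1) * (K * κ * (1 + q * ε + M * ε ^ 2)) =
      K * ((p - 1) * κ + (p - 1) * ε) + K * ε ^ 2 * ((p - 1) * κ * M) := by
    linear_combination (p - 1) * K * ε * hκq
  have h3 : (p - 1) * κ * M = (D - 1) / 2 := by rw [hD]; ring
  rw [h3] at h2
  have h4 : K * κ = K * ((p - 1) * (1 - κ)) := by rw [hpk]
  have h5 : 0 ≤ K * ε ^ 2 := by positivity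
  nlinarith

lemma hd_G {a p : ℝ} (ha : 1 < a) (hp : 1 < p) : ∃ C : ℝ, 0 < C ∧ ∃ G G' : ℝ → ℝ,
    ∀ s, a ≤ s → HasDerivAt G (G' s) s ∧ 0 < G s ∧
      ((1 / (p / (p - 1))) ^ p + C / (a - Real.log a + Real.log s) ^ 2) / s ^ p ≤
        - G' s - (p - 1) * (G s) ^ (p / (p - 1)) := by
  obtain ⟨c, C, hc, hC, H⟩ := hd_const hp
  have hp1 : 0 < p - 1 := by linarith
  set κ := 1 / (p / (p - 1)) with hκ
  have hκ0 : 0 < κ := by positivity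
  refine ⟨C, hC, fun s => κ ^ (p - 1) * (s ^ (1 - p) * (1 + c / (a - Real.log a + Real.log s))),
    fun s => - (κ ^ (p - 1) * ((p - 1) * (1 + c / (a - Real.log a + Real.log s)) +
      c / (a - Real.log a + Real.log s) ^ 2)) / s ^ p, fun s hs => ?_⟩
  have hs0 : 0 < s := by linarith
  have hL : 1 ≤ a - Real.log a + Real.log s := by
    have := sl_Fa_ge ha hs
    unfold Fa at this
    linarith
  have hH := H _ hL
  set L := a - Real.log a + Real.log s with hLdef
  have hL0 : 0 < L := by linarith
  have hsp : 0 < s ^ p := by positivity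
  have e1 : s ^ (1 - p) = s / s ^ p := by rw [Real.rpow_sub hs0, Real.rpow_one]
  refine ⟨?_, by positivity, ?_⟩
  · have d1 : HasDerivAt (fun s : ℝ => s ^ (1 - p)) ((1 - p) * s ^ (1 - p - 1)) s :=
      Real.hasDerivAt_rpow_const (Or.inl hs0.ne')
    have d2 : HasDerivAt (fun s : ℝ => 1 + c / (a - Real.log a + Real.log s))
        (c * (-(s⁻¹) / L ^ 2)) s := by
      have := ((((Real.hasDerivAt_log hs0.ne').const_add (a - Real.log a)).fun_inv
        hL0.ne').const_mul c).const_add 1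
      simpa only [div_eq_mul_inv] using this
    refine ((d1.mul d2).const_mul (κ ^ (p - 1))).congr_deriv ?_
    have e2 : s ^ (1 - p - 1) = 1 / s ^ p := by
      rw [show 1 - p - 1 = -p by ring, Real.rpow_neg hs0.le, one_div]
    simp only [← hLdef]
    rw [e1, e2]
    field_simp
    ring
  · have e3 : (κ ^ (p - 1) * (s ^ (1 - p) * (1 + c / L))) ^ (p / (p - 1)) =
        κ ^ p * (1 + c / L) ^ (p / (p - 1)) / s ^ p := by
      rw [Real.mul_rpow (by positivity) (by positivity),
        Real.mul_rpow (by positivity) (by positivity), ← Real.rpow_mul hκ0.le,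
        ← Real.rpow_mul hs0.le]
      have e4 : (p - 1) * (p / (p - 1)) = p := by field_simp
      have e5 : (1 - p) * (p / (p - 1)) = -p := by linear_combination -e4
      rw [e4, e5, Real.rpow_neg hs0.le]
      field_simp
    simp only [← hLdef]
    rw [e3, div_le_iff₀ hsp]
    refine hH.trans_eq ?_
    field_simp

lemma hd_young {p : ℝ} (hp : 1 < p) {w G g v v' : ℝ} (hw : 0 < w) (hG : 0 < G)
    (hg : |v'| ≤ g) :
    -(p * |v| ^ (p - 2) * v * v' * G) ≤
      g ^ p * w ^ (p - 1) + (p - 1) * (|v| ^ p * G ^ (p / (p - 1)) / w) := by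
  have hp1 : 0 < p - 1 := by linarith
  have hpq : p.HolderConjugate (p / (p - 1)) := Real.HolderConjugate.conjExponent hp
  have hg0 : 0 ≤ g := (abs_nonneg _).trans hg
  set q := p / (p - 1) with hq
  have hq0 : 0 < q := by positivity
  have hy := Real.young_inequality_of_nonneg (a := g * w ^ (1 / q))
    (b := |v| ^ (p - 1) * G * w ^ (-(1 / q))) (by positivity) (by positivity) hpq
  have e1 : (g * w ^ (1 / q)) ^ p = g ^ p * w ^ (p - 1) := by
    rw [Real.mul_rpow hg0 (by positivity), ← Real.rpow_mul hw.le]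
    congr 2
    rw [hq]; field_simp
  have e2 : (|v| ^ (p - 1) * G * w ^ (-(1 / q))) ^ q = |v| ^ p * G ^ q / w := by
    rw [Real.mul_rpow (by positivity) (by positivity),
      Real.mul_rpow (by positivity) (by positivity), ← Real.rpow_mul hw.le,
      ← Real.rpow_mul (abs_nonneg _)]
    rw [show (p - 1) * q = p by rw [hq]; field_simp,
      show -(1 / q) * q = -1 by field_simp, Real.rpow_neg_one]
    rfl
  have e3 : g * w ^ (1 / q) * (|v| ^ (p - 1) * G * w ^ (-(1 / q))) = g * |v| ^ (p - 1) * G := by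
    have : w ^ (1 / q) * w ^ (-(1 / q)) = 1 := by rw [← Real.rpow_add hw]; simp
    linear_combination g * |v| ^ (p - 1) * G * this
  rw [e1, e2, e3] at hy
  have e4 : -(p * |v| ^ (p - 2) * v * v' * G) ≤ p * (g * |v| ^ (p - 1) * G) := by
    have h1 : |v| ^ (p - 2) * |v| ≤ |v| ^ (p - 1) := by
      rcases (abs_nonneg v).eq_or_lt with h | h
      · rw [← h, mul_zero]; positivity
      · rw [← Real.rpow_add_one h.ne']; apply le_of_eq; ring_nf
    calc _ ≤ |-(p * |v| ^ (p - 2) * v * v' * G)| := le_abs_self _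
      _ = p * (|v'| * (|v| ^ (p - 2) * |v|) * G) := by
        rw [abs_neg, abs_mul, abs_mul, abs_mul, abs_mul, abs_of_pos hG,
          abs_of_pos (by linarith : 0 < p),
          abs_of_nonneg (by positivity : 0 ≤ |v| ^ (p - 2))]
        ring
      _ ≤ _ := by gcongr
  refine e4.trans ?_
  have hpp : 0 < p := by linarith
  calc p * (g * |v| ^ (p - 1) * G) ≤ p * (g ^ p * w ^ (p - 1) / p + |v| ^ p * G ^ q / w / q) := by
        gcongr
    _ = _ := by
        generalize |v| ^ p * G ^ q / w = Z
        rw [hq]; field_simp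

lemma hd_oneD {p κ C A : ℝ} (hp : 1 < p) {a : ℝ} {G G' : ℝ → ℝ}
    (hG : ∀ s, a ≤ s → HasDerivAt G (G' s) s ∧ 0 < G s ∧
      (κ + C / (A + Real.log s) ^ 2) / s ^ p ≤ - G' s - (p - 1) * (G s) ^ (p / (p - 1)))
    {η : ℝ} {w s v v' g f : ℝ → ℝ}
    (hw : ∀ t ∈ Ioo 0 η, 0 < w t) (hs : ∀ t ∈ Ioo 0 η, a ≤ s t)
    (hds : ∀ t ∈ Ioo 0 η, HasDerivAt s (-1 / w t) t)
    (hv : ∀ t ∈ Ioo 0 η, HasDerivAt v (v' t) t) (hg : ∀ t ∈ Ioo 0 η, |v' t| ≤ g t)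
    {ρ : ℝ} (hρ : ρ ∈ Ioo 0 η) (hv0 : ∀ t, ρ ≤ t → v t = 0) (hg0 : ∀ t, ρ ≤ t → g t = 0)
    (hf : ∀ t ∈ Ioo 0 η, f t = g t ^ p * w t ^ (p - 1) - κ * (|v t| ^ p / (w t * s t ^ p))
      - C * (|v t| ^ p / (w t * s t ^ p * (A + Real.log (s t)) ^ 2))) :
    0 ≤ ∫ t in Ioo 0 η, f t := by
  by_cases hfi : IntegrableOn f (Ioo 0 η)
  swap
  · rw [integral_undef hfi]
  have hfz : ∀ t ∈ Ioo 0 η, ρ ≤ t → f t = 0 := by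
    intro t ht h
    rw [hf t ht, hv0 t h, hg0 t h, abs_zero, Real.zero_rpow (by linarith)]
    simp
  have hsub : Ioc 0 ρ ⊆ Ioo 0 η := fun t ht => ⟨ht.1, ht.2.trans_lt hρ.2⟩
  have e1 : ∫ t in Ioo 0 η, f t = ∫ t in (0 : ℝ)..ρ, f t := by
    rw [intervalIntegral.integral_of_le hρ.1.le]
    refine (setIntegral_eq_of_subset_of_forall_sdiff_eq_zero measurableSet_Ioo hsub ?_)
    intro t ht
    refine hfz t ht.1 ?_
    by_contra! h
    exact ht.2 ⟨ht.1.1, h.le⟩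
  rw [e1]
  have hfi' : IntegrableOn f (uIcc 0 ρ) := by
    rw [uIcc_of_le hρ.1.le, integrableOn_Icc_iff_integrableOn_Ioc]
    exact hfi.mono_set hsub
  have hstep : ∀ ε ∈ Ioo 0 ρ, 0 ≤ ∫ t in ε..ρ, f t := by
    intro ε hε
    have hsub2 : Icc ε ρ ⊆ Ioo 0 η := fun t ht => ⟨hε.1.trans_le ht.1, ht.2.trans_lt hρ.2⟩
    have hd : ∀ t ∈ Ioo 0 η, HasDerivAt (fun t => -(|v t| ^ p * G (s t)))
        (-(p * |v t| ^ (p - 2) * v t * v' t * G (s t) +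
          |v t| ^ p * (G' (s t) * (-1 / w t)))) t := by
      intro t ht
      exact (((hasDerivAt_abs_rpow (v t) hp).comp t (hv t ht)).mul
        ((hG _ (hs t ht)).1.comp t (hds t ht))).neg
    have h := intervalIntegral.sub_le_integral_of_hasDeriv_right_of_le hε.2.le
      (g := fun t => -(|v t| ^ p * G (s t)))
      (g' := fun t => -(p * |v t| ^ (p - 2) * v t * v' t * G (s t) +
          |v t| ^ p * (G' (s t) * (-1 / w t)))) (φ := f)
      (fun t ht => (hd t (hsub2 ht)).continuousAt.continuousWithinAt)
      (fun t ht => (hd t (hsub2 ⟨ht.1.le, ht.2.le⟩)).hasDerivWithinAt)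
      (hfi.mono_set hsub2) ?_
    · refine le_trans ?_ h
      have := (hG _ (hs ε (hsub2 ⟨le_rfl, hε.2.le⟩))).2.1
      simp only [hv0 ρ le_rfl, abs_zero, Real.zero_rpow (by linarith : p ≠ 0)]
      have h2 : 0 ≤ |v ε| ^ p * G (s ε) := by positivity
      linarith
    · intro t ht
      have ht' := hsub2 ⟨ht.1.le, ht.2.le⟩
      have hwt := hw t ht'
      obtain ⟨-, h2, h3⟩ := hG _ (hs t ht')
      have hy := hd_young hp (v := v t) hwt h2 (hg t ht')
      rw [hf t ht']
      have hZ : 0 ≤ |v t| ^ p / w t := by positivity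
      have h4 := mul_le_mul_of_nonneg_left h3 hZ
      have e5 : |v t| ^ p / w t * ((κ + C / (A + Real.log (s t)) ^ 2) / s t ^ p) =
        κ * (|v t| ^ p / (w t * s t ^ p))
          + C * (|v t| ^ p / (w t * s t ^ p * (A + Real.log (s t)) ^ 2)) := by
        simp only [div_eq_mul_inv, mul_inv]; ring
      rw [e5] at h4
      have e6 : |v t| ^ p / w t * (-G' (s t) - (p - 1) * G (s t) ^ (p / (p - 1))) =
        |v t| ^ p * (G' (s t) * (-1 / w t)) -
          (p - 1) * (|v t| ^ p * G (s t) ^ (p / (p - 1)) / w t) := by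
        simp only [div_eq_mul_inv]; ring
      rw [e6] at h4
      linarith
  have hcont := intervalIntegral.continuousOn_primitive_interval_left hfi'
  have ht := hcont 0 left_mem_uIcc
  rw [uIcc_of_le hρ.1.le] at ht
  have ht2 := ht.mono (Ioo_subset_Icc_self)
  have : (𝓝[Ioo 0 ρ] (0 : ℝ)).NeBot := left_nhdsWithin_Ioo_neBot hρ.1
  exact ge_of_tendsto ht2 (eventually_of_mem self_mem_nhdsWithin hstep)

lemma hd_polar {n : ℕ} (hn : 1 ≤ n) (f : EuclideanSpace ℝ (Fin n) → ℝ)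
    (h : ∀ ω : EuclideanSpace ℝ (Fin n), ‖ω‖ = 1 →
      0 ≤ ∫ r in Ioi (0 : ℝ), r ^ (n - 1) * f (r • ω)) : 0 ≤ ∫ x, f x := by
  have : Nonempty (Fin n) := ⟨⟨0, hn⟩⟩
  by_cases hf : Integrable f
  swap
  · rw [integral_undef hf]
  have hfr : Module.finrank ℝ (EuclideanSpace ℝ (Fin n)) = n := finrank_euclideanSpace_fin
  have hmp := (volume : Measure (EuclideanSpace ℝ (Fin n))).measurePreserving_homeomorphUnitSphereProd
  set g : Metric.sphere (0 : (EuclideanSpace ℝ (Fin n))) 1 × Ioi (0 : ℝ) → ℝ := fun z => f (z.2.1 • z.1.1) with hg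
  have hgf : ∀ x : ({0}ᶜ : Set (EuclideanSpace ℝ (Fin n))), g (homeomorphUnitSphereProd (EuclideanSpace ℝ (Fin n)) x) = f x.1 := by
    intro x
    have hx : ‖x.1‖ ≠ 0 := norm_ne_zero_iff.2 x.2
    simp [hg, smul_smul, hx]
  have e1 : ∫ x, f x = ∫ z, g z ∂((volume : Measure (EuclideanSpace ℝ (Fin n))).toSphere.prod
      (.volumeIoiPow (Module.finrank ℝ (EuclideanSpace ℝ (Fin n)) - 1))) := by
    rw [← hmp.integral_comp (Homeomorph.measurableEmbedding _) g]
    simp only [hgf]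
    rw [integral_subtype_comap (measurableSet_singleton _).compl f, restrict_compl_singleton]
  have hgi : Integrable g ((volume : Measure (EuclideanSpace ℝ (Fin n))).toSphere.prod
      (.volumeIoiPow (Module.finrank ℝ (EuclideanSpace ℝ (Fin n)) - 1))) := by
    rw [← hmp.integrable_comp_emb (Homeomorph.measurableEmbedding _)]
    have : g ∘ (homeomorphUnitSphereProd (EuclideanSpace ℝ (Fin n))) = f ∘ Subtype.val := funext hgf
    rw [this, ← integrableOn_iff_comap_subtypeVal (measurableSet_singleton _).compl]
    exact hf.integrableOn
  rw [e1, integral_prod _ hgi]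
  refine integral_nonneg fun ω => ?_
  have e2 : ∫ r, g (ω, r) ∂(Measure.volumeIoiPow (Module.finrank ℝ (EuclideanSpace ℝ (Fin n)) - 1)) =
      ∫ r in Ioi (0 : ℝ), r ^ (n - 1) * f (r • ω.1) := by
    simp only [Measure.volumeIoiPow, ENNReal.ofReal]
    rw [integral_withDensity_eq_integral_smul,
      integral_subtype_comap measurableSet_Ioi
        fun r : ℝ ↦ Real.toNNReal (r ^ (Module.finrank ℝ (EuclideanSpace ℝ (Fin n)) - 1)) • f (r • ω.1),
      setIntegral_congr_fun measurableSet_Ioi fun x hx ↦ ?_]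
    · rw [NNReal.smul_def, Real.coe_toNNReal _ (pow_nonneg (mem_Ioi.1 hx).le _), hfr, smul_eq_mul]
    · exact (measurable_subtype_coe.pow_const _).real_toNNReal
  simp only [Pi.zero_apply]
  rw [e2]
  exact h _ (by simpa using ω.2)

lemma hd_int1 {w : ℝ → ℝ} {η p W : ℝ} (hp : 1 < p) (hw : ∀ t ∈ Ioo 0 η, 0 < w t)
    (hW : ∀ t ∈ Ioo 0 η, w t ≤ W) (hwc : ContinuousOn w (Ioo 0 η)) :
    IntegrableOn (fun t => w t ^ (p - 1)) (Ioo 0 η) := by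
  have hc : ContinuousOn (fun t => w t ^ (p - 1)) (Ioo 0 η) :=
    hwc.rpow_const fun t ht => Or.inl (hw t ht).ne'
  refine Integrable.of_bound
    (hc.aestronglyMeasurable measurableSet_Ioo) (W ^ (p - 1)) ?_
  filter_upwards [ae_restrict_mem measurableSet_Ioo] with t ht
  have := hw t ht
  rw [Real.norm_of_nonneg (by positivity)]
  exact Real.rpow_le_rpow this.le (hW t ht) (by linarith)

lemma hd_int2 {a : ℝ} (ha : 1 < a) {w s : ℝ → ℝ} {η p : ℝ} (hη : 0 < η) (hp : 1 < p)
    (hw : ∀ t ∈ Ioo 0 η, 0 < w t)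
    (hwc : ContinuousOn w (Ioo 0 η)) (hs : ∀ t ∈ Ioo 0 η, a ≤ s t)
    (hds : ∀ t ∈ Ioo 0 η, HasDerivAt s (-1 / w t) t) :
    IntegrableOn (fun t => 1 / (w t * s t ^ p)) (Ioo 0 η) := by
  have hp1 : 0 < p - 1 := by linarith
  have hsc : ContinuousOn s (Ioo 0 η) := fun t ht => (hds t ht).continuousAt.continuousWithinAt
  have hs0 : ∀ t ∈ Ioo 0 η, 0 < s t := fun t ht => by linarith [hs t ht]
  have hc : ContinuousOn (fun t => 1 / (w t * s t ^ p)) (Ioo 0 η) := by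
    refine continuousOn_const.div
      (hwc.mul (hsc.rpow_const fun t ht => Or.inl (hs0 t ht).ne')) fun t ht => ?_
    have := hw t ht
    have := hs0 t ht
    positivity
  have hd : ∀ t ∈ Ioo 0 η, HasDerivAt (fun t => s t ^ (1 - p) / (p - 1))
      (1 / (w t * s t ^ p)) t := by
    intro t ht
    have h0 := hs0 t ht
    have hw0 := hw t ht
    refine (((hds t ht).rpow_const (p := 1 - p) (Or.inl h0.ne')).div_const (p - 1)).congr_deriv ?_
    rw [show 1 - p - 1 = -p by ring, Real.rpow_neg h0.le]
    field_simp
    ring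
  rw [← integrableOn_Ioc_iff_integrableOn_Ioo]
  set d : ℕ → ℝ := fun i => η / 2 * (1 / ((i : ℝ) + 1)) with hdd
  have hd0 : ∀ i, 0 < d i := fun i => by positivity
  have hd1 : ∀ i, d i ≤ η / 2 := fun i => by
    have : 1 / ((i : ℝ) + 1) ≤ 1 := by
      rw [div_le_one (by positivity)]
      have : (0 : ℝ) ≤ i := by positivity
      linarith
    have h2 : 0 < η / 2 := by positivity
    calc d i ≤ η / 2 * 1 := by simp only [hdd]; gcongr
      _ = _ := mul_one _
  have hdt : Tendsto d atTop (𝓝 0) := by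
    have := (tendsto_one_div_add_atTop_nhds_zero_nat (𝕜 := ℝ)).const_mul (η / 2)
    rwa [mul_zero] at this
  have hsub : ∀ i, Icc (d i) (η - d i) ⊆ Ioo 0 η := fun i t ht =>
    ⟨(hd0 i).trans_le ht.1, by linarith [ht.2, hd0 i]⟩
  have hint : ∀ i, IntegrableOn (fun t => 1 / (w t * s t ^ p)) (Icc (d i) (η - d i)) :=
    fun i => (hc.mono (hsub i)).integrableOn_Icc
  refine integrableOn_Ioc_of_intervalIntegral_norm_bounded (l := atTop) (a := d)
    (b := fun i => η - d i)
    (I := 1 ^ (1 - p) / (p - 1)) (fun i => (hint i).mono_set Ioc_subset_Icc_self) hdt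
    (by simpa using hdt.const_sub η) (Eventually.of_forall fun i => ?_)
  have hle : d i ≤ η - d i := by linarith [hd1 i]
  have e1 : ∫ t in Ioc (d i) (η - d i), ‖1 / (w t * s t ^ p)‖ =
      ∫ t in (d i)..(η - d i), 1 / (w t * s t ^ p) := by
    rw [intervalIntegral.integral_of_le hle]
    refine setIntegral_congr_fun measurableSet_Ioc fun t ht => ?_
    have ht' := hsub i (Ioc_subset_Icc_self ht)
    have := hw t ht'
    have := hs0 t ht'
    rw [Real.norm_of_nonneg (by positivity)]
  rw [e1, intervalIntegral.integral_eq_sub_of_hasDerivAt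
    (f := fun t => s t ^ (1 - p) / (p - 1))]
  · have h1 := hs0 _ (hsub i ⟨le_rfl, hle⟩)
    have h2 := hs _ (hsub i ⟨hle, le_rfl⟩)
    have h3 : 0 ≤ s (d i) ^ (1 - p) / (p - 1) := by positivity
    have h4 : s (η - d i) ^ (1 - p) ≤ 1 ^ (1 - p) :=
      Real.rpow_le_rpow_of_nonpos one_pos (by linarith) (by linarith)
    have h5 : s (η - d i) ^ (1 - p) / (p - 1) ≤ 1 ^ (1 - p) / (p - 1) := by gcongr
    linarith
  · intro t ht
    rw [uIcc_of_le hle] at ht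
    exact hd t (hsub i ht)
  · rw [intervalIntegrable_iff_integrableOn_Icc_of_le hle]
    exact hint i

lemma hd_int3 {a A : ℝ} (ha : 1 < a) {w s : ℝ → ℝ} {η p : ℝ} (hη : 0 < η) (hp : 1 < p)
    (hw : ∀ t ∈ Ioo 0 η, 0 < w t)
    (hwc : ContinuousOn w (Ioo 0 η)) (hs : ∀ t ∈ Ioo 0 η, a ≤ s t)
    (hL : ∀ t ∈ Ioo 0 η, 1 ≤ A + Real.log (s t))
    (hds : ∀ t ∈ Ioo 0 η, HasDerivAt s (-1 / w t) t) :
    IntegrableOn (fun t => 1 / (w t * s t ^ p * (A + Real.log (s t)) ^ 2)) (Ioo 0 η) := by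
  have hsc : ContinuousOn s (Ioo 0 η) := fun t ht => (hds t ht).continuousAt.continuousWithinAt
  have hs0 : ∀ t ∈ Ioo 0 η, 0 < s t := fun t ht => by linarith [hs t ht]
  have hc : ContinuousOn (fun t => 1 / (w t * s t ^ p * (A + Real.log (s t)) ^ 2)) (Ioo 0 η) := by
    refine continuousOn_const.div
      ((hwc.mul (hsc.rpow_const fun t ht => Or.inl (hs0 t ht).ne')).mul
        ((continuousOn_const.add (hsc.log fun t ht => (hs0 t ht).ne')).pow 2)) fun t ht => ?_
    have := hw t ht
    have := hs0 t ht
    have := hL t ht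
    positivity
  refine Integrable.mono (hd_int2 ha hη hp hw hwc hs hds)
    (hc.aestronglyMeasurable measurableSet_Ioo) ?_
  filter_upwards [ae_restrict_mem measurableSet_Ioo] with t ht
  have h1 := hw t ht
  have h2 := hs0 t ht
  have h3 := hL t ht
  have h4 : 1 ≤ (A + Real.log (s t)) ^ 2 := one_le_pow₀ h3
  have h5 : 0 < w t * s t ^ p := by positivity
  rw [Real.norm_of_nonneg (by positivity), Real.norm_of_nonneg (by positivity)]
  exact one_div_le_one_div_of_le h5 (by nlinarith)

lemma hd_radial {n : ℕ} (hn : 1 ≤ n) {η : ℝ} {R Q : ℝ → ℝ} (hR : IntegrableOn R (Ioo 0 η))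
    (hQ : ∀ t ∈ Ioo 0 η, Q t = R t * t ^ (1 - (n : ℝ))) :
    IntegrableOn (fun x : EuclideanSpace ℝ (Fin n) => Q ‖x‖) (Metric.ball 0 η) := by
  have : Nonempty (Fin n) := ⟨⟨0, hn⟩⟩
  rw [integrableOn_fun_norm_addHaar]
  refine hR.congr_fun (fun t ht => ?_) measurableSet_Ioo
  simp only [finrank_euclideanSpace_fin, smul_eq_mul]
  rw [hQ t ht, ← Real.rpow_natCast, Nat.cast_sub hn, mul_comm (R t), ← mul_assoc,
    ← Real.rpow_add ht.1]
  simp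

lemma hd_bdd {n : ℕ} {η p : ℝ} (hp : 1 < p) {F : Type*} [NormedAddCommGroup F]
    {U : EuclideanSpace ℝ (Fin n) → F}
    (hU : Continuous U) (hUc : HasCompactSupport U) {Q : ℝ → ℝ}
    (hQ : IntegrableOn (fun x : EuclideanSpace ℝ (Fin n) => Q ‖x‖) (Metric.ball 0 η)) :
    IntegrableOn (fun x => ‖U x‖ ^ p * Q ‖x‖) (Metric.ball 0 η) := by
  obtain ⟨K, hK⟩ := hU.bounded_above_of_compact_support hUc
  refine Integrable.bdd_mul (c := K ^ p) hQ ?_ (Eventually.of_forall fun x => ?_)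
  · exact (hU.norm.rpow_const fun x => Or.inr (by linarith)).aestronglyMeasurable
  · rw [Real.norm_of_nonneg (by positivity)]
    exact Real.rpow_le_rpow (norm_nonneg _) (hK x) (by linarith)
/-- Hardy-type inequality with super-logarithmic weight and sharp remainder: for `n ≥ 1`,
`k ∈ ℕ∪{0}`, `1 < p < ∞`, `η > 0` and `a > 1`, there is `C > 0` such that for all
`u ∈ C_c^∞(B_η)`,
`∫_{B_η} |∇u|^p w^{sl}_{k,1}(|x|)^{p−1} |x|^{1−n} ≥
 (1/p')^p ∫_{B_η} |u|^p |x|^{1−n}/(w^{sl}_{k,1}(|x|)·A^1_{k+1}(η/|x|)^p)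
 + C ∫_{B_η} |u|^p |x|^{1−n}/(w^{sl}_{k,1}(|x|)·A^1_{k+1}(η/|x|)^p·(a − log a + log A^1_{k+1}(η/|x|))²)`. -/
theorem stmt19 (a : ℝ) (ha : 1 < a) (n k : ℕ) (hn : 1 ≤ n) (p : ℝ) (hp : 1 < p)
    (η : ℝ) (hη : 0 < η) :
    ∃ C : ℝ, 0 < C ∧ ∀ u : EuclideanSpace ℝ (Fin n) → ℝ,
      ContDiff ℝ (⊤ : ℕ∞) u → HasCompactSupport u →
      tsupport u ⊆ Metric.ball 0 η →
      ∫ x in Metric.ball (0 : EuclideanSpace ℝ (Fin n)) η,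
          ‖fderiv ℝ u x‖ ^ p * (wsl a k 1 η ‖x‖) ^ (p - 1) * ‖x‖ ^ (1 - (n : ℝ)) ≥
        (1 / (p / (p - 1))) ^ p *
            ∫ x in Metric.ball (0 : EuclideanSpace ℝ (Fin n)) η,
              |u x| ^ p * ‖x‖ ^ (1 - (n : ℝ)) /
                (wsl a k 1 η ‖x‖ * (A1 a (k + 1) (η / ‖x‖)) ^ p) +
          C * ∫ x in Metric.ball (0 : EuclideanSpace ℝ (Fin n)) η,
              |u x| ^ p * ‖x‖ ^ (1 - (n : ℝ)) /
                (wsl a k 1 η ‖x‖ * (A1 a (k + 1) (η / ‖x‖)) ^ p *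
                  (a - Real.log a + Real.log (A1 a (k + 1) (η / ‖x‖))) ^ 2) := by
  obtain ⟨C, hC, G, G', hG⟩ := hd_G ha hp
  -- In the formal statement the second integral on the right is inside the first one (as a
  -- constant), so it is multiplied by `(1/p')^p * vol(B_η)`; we rescale the constant accordingly.
  set V : ℝ := volume.real (Metric.ball (0 : EuclideanSpace ℝ (Fin n)) η) with hV
  have hV0 : 0 < V := ENNReal.toReal_pos (Metric.measure_ball_pos _ _ hη).ne'
    measure_ball_lt_top.ne
  set c : ℝ := (1 / (p / (p - 1))) ^ p with hc
  have hc0 : 0 < c := by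
    have : 0 < p - 1 := by linarith
    positivity
  refine ⟨C / (c * V), by positivity, fun u hu huc hus => ?_⟩
  set w := wsl a k 1 η with hwdef
  set s : ℝ → ℝ := fun t => A1 a (k + 1) (η / t) with hsdef
  have hw : ∀ t ∈ Ioo 0 η, 0 < w t := fun t ht => sl_w_pos ha ht k
  have hwc : ContinuousOn w (Ioo 0 η) := sl_w_cont ha k
  obtain ⟨W, hW⟩ := sl_w_le (η := η) ha k
  have hs : ∀ t ∈ Ioo 0 η, a ≤ s t := fun t ht => sl_A1_ge ha ht (k + 1)
  have hds : ∀ t ∈ Ioo 0 η, HasDerivAt s (-1 / w t) t := fun t ht => sl_s_deriv ha ht k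
  have hL : ∀ t ∈ Ioo 0 η, 1 ≤ a - Real.log a + Real.log (s t) := fun t ht => by
    have := sl_Fa_ge ha (hs t ht)
    unfold Fa at this
    linarith
  have hfc : Continuous (fderiv ℝ u) := hu.continuous_fderiv (by simp)
  have i1 := hd_bdd (η := η) (Q := fun t => w t ^ (p - 1) * t ^ (1 - (n : ℝ))) hp hfc
    (huc.fderiv (𝕜 := ℝ)) (hd_radial hn (hd_int1 hp hw hW hwc) fun t _ => rfl)
  have i2 := hd_bdd (η := η) (Q := fun t => 1 / (w t * s t ^ p) * t ^ (1 - (n : ℝ))) hp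
    hu.continuous huc (hd_radial hn (hd_int2 ha hη hp hw hwc hs hds) fun t _ => rfl)
  have i3 := hd_bdd (η := η)
    (Q := fun t => 1 / (w t * s t ^ p * (a - Real.log a + Real.log (s t)) ^ 2) *
      t ^ (1 - (n : ℝ))) hp hu.continuous huc (hd_radial hn
    (hd_int3 ha hη hp hw hwc hs hL hds) fun t _ => rfl)
  have i1' : IntegrableOn (fun x => ‖fderiv ℝ u x‖ ^ p * w ‖x‖ ^ (p - 1) * ‖x‖ ^ (1 - (n : ℝ)))
      (Metric.ball 0 η) := i1.congr_fun (fun x _ => by ring) measurableSet_ball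
  have i2' : IntegrableOn (fun x => |u x| ^ p * ‖x‖ ^ (1 - (n : ℝ)) / (w ‖x‖ * s ‖x‖ ^ p))
      (Metric.ball 0 η) := i2.congr_fun (fun x _ => by
        simp only [Real.norm_eq_abs]; ring) measurableSet_ball
  have i3' : IntegrableOn (fun x => |u x| ^ p * ‖x‖ ^ (1 - (n : ℝ)) /
      (w ‖x‖ * s ‖x‖ ^ p * (a - Real.log a + Real.log (s ‖x‖)) ^ 2))
      (Metric.ball 0 η) := i3.congr_fun (fun x _ => by
        simp only [Real.norm_eq_abs]; ring) measurableSet_ball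
  -- the support stays away from the boundary sphere
  obtain ⟨ρ, hρ, hρ0⟩ : ∃ ρ ∈ Ioo 0 η, ∀ x, ρ ≤ ‖x‖ → x ∉ tsupport u := by
    obtain ⟨r, hr, hr2⟩ := exists_lt_subset_ball (isClosed_tsupport u) hus
    refine ⟨max r (η / 2), ⟨by positivity, max_lt hr (by linarith)⟩, fun x hx hx2 => ?_⟩
    have := hr2 hx2
    rw [mem_ball_zero_iff] at this
    linarith [le_max_left r (η / 2)]
  have hmain : 0 ≤ ∫ x in Metric.ball (0 : EuclideanSpace ℝ (Fin n)) η,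
      (‖fderiv ℝ u x‖ ^ p * w ‖x‖ ^ (p - 1) * ‖x‖ ^ (1 - (n : ℝ))
        - c *
          (|u x| ^ p * ‖x‖ ^ (1 - (n : ℝ)) / (w ‖x‖ * s ‖x‖ ^ p))
        - C * (|u x| ^ p * ‖x‖ ^ (1 - (n : ℝ)) /
            (w ‖x‖ * s ‖x‖ ^ p * (a - Real.log a + Real.log (s ‖x‖)) ^ 2))) := by
    rw [← integral_indicator measurableSet_ball]
    refine hd_polar hn _ fun ω hω => ?_
    have hnorm : ∀ t : ℝ, 0 < t → ‖t • ω‖ = t := fun t ht => by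
      rw [norm_smul, hω, mul_one, Real.norm_of_nonneg ht.le]
    have hone := hd_oneD hp hG hw hs hds (v := fun t => u (t • ω))
      (v' := fun t => fderiv ℝ u (t • ω) ω) (g := fun t => ‖fderiv ℝ u (t • ω)‖) ?_ ?_
      hρ ?_ ?_ (fun t _ => rfl)
    · refine hone.trans_eq ?_
      rw [← integral_indicator measurableSet_Ioo, ← integral_indicator measurableSet_Ioi]
      congr 1
      funext t
      by_cases ht : 0 < t
      · by_cases ht2 : t < η
        · rw [indicator_of_mem (show t ∈ Ioo 0 η from ⟨ht, ht2⟩),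
            indicator_of_mem (show t ∈ Ioi 0 from ht),
            indicator_of_mem (show t • ω ∈ Metric.ball 0 η by
              rw [mem_ball_zero_iff, hnorm t ht]; exact ht2), hnorm t ht]
          have e : t ^ (n - 1) * t ^ (1 - (n : ℝ)) = 1 := by
            rw [← Real.rpow_natCast, Nat.cast_sub hn, ← Real.rpow_add ht]
            simp
          simp only [div_eq_mul_inv]
          linear_combination (-(‖fderiv ℝ u (t • ω)‖ ^ p * w t ^ (p - 1)
            - c *
              (|u (t • ω)| ^ p * (w t * s t ^ p)⁻¹)
            - C * (|u (t • ω)| ^ p *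
            (w t * s t ^ p * (a - Real.log a + Real.log (s t)) ^ 2)⁻¹))) * e
        · rw [indicator_of_notMem (show t ∉ Ioo 0 η from fun h => ht2 h.2),
            indicator_of_mem (show t ∈ Ioi 0 from ht),
            indicator_of_notMem (show t • ω ∉ Metric.ball 0 η by
              rw [mem_ball_zero_iff, hnorm t ht]; exact ht2), mul_zero]
      · rw [indicator_of_notMem (show t ∉ Ioo 0 η from fun h => ht h.1),
            indicator_of_notMem (show t ∉ Ioi 0 from ht)]
    · intro t _
      have h1 : HasDerivAt (fun t : ℝ => t • ω) ω t := by
        simpa using (hasDerivAt_id t).smul_const ω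
      exact ((hu.differentiable (by simp)) (t • ω)).hasFDerivAt.comp_hasDerivAt t h1
    · intro t _
      have := (fderiv ℝ u (t • ω)).le_opNorm ω
      rwa [hω, mul_one, Real.norm_eq_abs] at this
    · intro t ht
      exact image_eq_zero_of_notMem_tsupport
        (hρ0 _ (by rw [hnorm t (hρ.1.trans_le ht)]; exact ht))
    · intro t ht
      have h1 := hρ0 (t • ω) (by rw [hnorm t (hρ.1.trans_le ht)]; exact ht)
      have h2 : fderiv ℝ u (t • ω) = 0 :=
        image_eq_zero_of_notMem_tsupport fun h => h1 (tsupport_fderiv_subset ℝ h)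
      simp only [h2, norm_zero]
  have e1 := integral_sub (i1'.sub (i2'.const_mul c)) (i3'.const_mul C)
  have e2 := integral_sub i1' (i2'.const_mul c)
  simp only [Pi.sub_apply] at e1
  rw [e1, e2, integral_const_mul, integral_const_mul] at hmain
  rw [ge_iff_le, integral_add i2' (integrableOn_const measure_ball_lt_top.ne), setIntegral_const,
    ← hV, smul_eq_mul]
  have e3 : ∀ I2 I3 : ℝ, c * (I2 + V * (C / (c * V) * I3)) = c * I2 + C * I3 := by
    intro I2 I3
    field_simp
  rw [e3]
  linarith
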